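/- (Generalized Groenewold–Lindblad inequality.) Let {p_i, ρ_i} be an ensemble of letter states on a finite alphabet A with average state η_i, and let I be an instrument with finite outcome set Ω. Then I_q(η_i; I) − Σ_α p_i(α) I_q(ρ_i(α); I) ≥ I_c{p_i, ρ_i; E_I} ≥ 0, where I_q(η; I) = S_q(η) − Σ_{ω: p_η(ω)>0} p_η(ω) S_q(π_η(ω)) is the quantum information gain of I on the state η. -/

import Mathlib

open Matrix Finset
open scoped BigOperators ComplexOrder

noncomputable section

/-- Matrix logarithm of a Hermitian matrix via the spectral decomposition
(with the convention `Real.log 0 = 0` on the kernel); `0` for non-Hermitian matrices. -/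
def matLog {d : ℕ} (A : Matrix (Fin d) (Fin d) ℂ) : Matrix (Fin d) (Fin d) ℂ :=
  if hA : A.IsHermitian then
    (hA.eigenvectorUnitary : Matrix (Fin d) (Fin d) ℂ) *
      Matrix.diagonal (fun i => (Real.log (hA.eigenvalues i) : ℂ)) *
      star (hA.eigenvectorUnitary : Matrix (Fin d) (Fin d) ℂ)
  else 0

/-- The von Neumann entropy `S_q(ρ) = −Tr(ρ log ρ)`. -/
def vnEntropy {d : ℕ} (ρ : Matrix (Fin d) (Fin d) ℂ) : ℝ :=
  -(Matrix.trace (ρ * matLog ρ)).re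

/-- The quantum relative entropy `S_q(ρ‖φ) = Tr(ρ (log ρ − log φ))`. -/
def qRelEntropy {d : ℕ} (ρ φ : Matrix (Fin d) (Fin d) ℂ) : ℝ :=
  (Matrix.trace (ρ * (matLog ρ - matLog φ))).re

/-- The classical relative entropy `S_c(p‖q) = Σ_{ω : p ω > 0} p ω log (p ω / q ω)`. -/
def cRelEntropy {Ω : Type*} [Fintype Ω] (p q : Ω → ℝ) : ℝ :=
  ∑ ω ∈ Finset.univ.filter (fun ω => 0 < p ω), p ω * Real.log (p ω / q ω)

/-- The probability of outcome `ω` for POV measure `E` in the state `ρ`. -/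
def povProb {d : ℕ} {Ω : Type*} (E : Ω → Matrix (Fin d) (Fin d) ℂ)
    (ρ : Matrix (Fin d) (Fin d) ℂ) (ω : Ω) : ℝ :=
  (Matrix.trace (E ω * ρ)).re

/-- The χ-quantity of the ensemble `{p, σ}` (relative entropies w.r.t. the average state). -/
def chiQuantity {d : ℕ} {X : Type*} [Fintype X] (p : X → ℝ)
    (σ : X → Matrix (Fin d) (Fin d) ℂ) : ℝ :=
  ∑ x ∈ Finset.univ.filter (fun x => 0 < p x),
    p x * qRelEntropy (σ x) (∑ y, p y • σ y)

/-- The operation `O(ω)[ρ] = Σ_k V_k^ω ρ (V_k^ω)†` of the instrument with Kraus family `V`. -/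
def instrOp {d : ℕ} {Ω K : Type*} [Fintype K] (V : Ω → K → Matrix (Fin d) (Fin d) ℂ)
    (ω : Ω) (ρ : Matrix (Fin d) (Fin d) ℂ) : Matrix (Fin d) (Fin d) ℂ :=
  ∑ k, V ω k * ρ * (V ω k)ᴴ

/-- The POV measure `E(ω) = Σ_k (V_k^ω)† V_k^ω` associated with the instrument `V`. -/
def instrPOV {d : ℕ} {Ω K : Type*} [Fintype K] (V : Ω → K → Matrix (Fin d) (Fin d) ℂ)
    (ω : Ω) : Matrix (Fin d) (Fin d) ℂ :=
  ∑ k, (V ω k)ᴴ * V ω k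

/-- The outcome probability `p_ρ(ω) = Tr(E(ω) ρ)` of the instrument `V`. -/
def outcomeProb {d : ℕ} {Ω K : Type*} [Fintype K] (V : Ω → K → Matrix (Fin d) (Fin d) ℂ)
    (ρ : Matrix (Fin d) (Fin d) ℂ) (ω : Ω) : ℝ :=
  (Matrix.trace (instrPOV V ω * ρ)).re

/-- The a posteriori state `π_ρ(ω) = O(ω)[ρ] / p_ρ(ω)` of the instrument `V`. -/
def postState {d : ℕ} {Ω K : Type*} [Fintype K] (V : Ω → K → Matrix (Fin d) (Fin d) ℂ)
    (ρ : Matrix (Fin d) (Fin d) ℂ) (ω : Ω) : Matrix (Fin d) (Fin d) ℂ :=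
  (outcomeProb V ρ ω)⁻¹ • instrOp V ω ρ

/-- The classical input/output mutual information `I_c{p, ρ; E}` for the ensemble `{p, ρ}`
measured with the POV measure `E`. -/
def mutualInfo {d : ℕ} {A Ω : Type*} [Fintype A] [Fintype Ω]
    (p : A → ℝ) (ρ : A → Matrix (Fin d) (Fin d) ℂ)
    (E : Ω → Matrix (Fin d) (Fin d) ℂ) : ℝ :=
  ∑ x ∈ Finset.univ.filter (fun x : A × Ω => 0 < p x.1 * povProb E (ρ x.1) x.2),
    (p x.1 * povProb E (ρ x.1) x.2) *
      Real.log ((p x.1 * povProb E (ρ x.1) x.2) /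
        (p x.1 * povProb E (∑ α, p α • ρ α) x.2))

/-- The quantum information gain `I_q(ρ; I)` of the instrument `V` on the state `ρ`. -/
def infoGain {d : ℕ} {Ω K : Type*} [Fintype Ω] [Fintype K]
    (V : Ω → K → Matrix (Fin d) (Fin d) ℂ) (ρ : Matrix (Fin d) (Fin d) ℂ) : ℝ :=
  vnEntropy ρ - ∑ ω ∈ Finset.univ.filter (fun ω => 0 < outcomeProb V ρ ω),
    outcomeProb V ρ ω * vnEntropy (postState V ρ ω)

/-- A pure state: a rank-one orthogonal projection. -/
def IsPureState {d : ℕ} (ρ : Matrix (Fin d) (Fin d) ℂ) : Prop :=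
  ρ.IsHermitian ∧ ρ * ρ = ρ ∧ ρ.rank = 1

end
open Filter Topology in
/-- If the resolvent-type sums `∑ c a² / (b + t a)` of two nonnegative families are ordered for all
`t > 0` and the masses `∑ c a` agree, then the entropy-type sums `∑ c a (log a - log b)` are
ordered in the same way. -/
lemma sum_mul_log_sub_log_le {ι κ : Type*} [Fintype ι] [Fintype κ]
    (c a b : ι → ℝ) (c' a' b' : κ → ℝ)
    (ha : ∀ i, 0 ≤ a i) (hb : ∀ i, 0 ≤ b i) (ha' : ∀ i, 0 ≤ a' i) (hb' : ∀ i, 0 ≤ b' i)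
    (hs : ∀ i, b i = 0 → c i * a i = 0) (hs' : ∀ i, b' i = 0 → c' i * a' i = 0)
    (hmass : ∑ i, c' i * a' i = ∑ i, c i * a i)
    (hres : ∀ t > 0, ∑ i, c' i * (a' i ^ 2 / (b' i + t * a' i)) ≤
      ∑ i, c i * (a i ^ 2 / (b i + t * a i))) :
    ∑ i, c' i * a' i * (Real.log (a' i) - Real.log (b' i)) ≤
      ∑ i, c i * a i * (Real.log (a i) - Real.log (b i)) := by
  have deriv_term : ∀ (c a b : ℝ), 0 ≤ a → 0 ≤ b → ∀ t > 0,
      HasDerivAt (fun t => c * a * Real.log (b + t * a)) (c * (a ^ 2 / (b + t * a))) t := by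
    intro c a b ha hb t ht
    rcases ha.eq_or_lt with rfl | ha
    · simpa using hasDerivAt_const t (0 : ℝ)
    · have hpos : b + t * a ≠ 0 := by positivity
      have h := ((((hasDerivAt_id t).mul_const a).const_add b).log hpos).const_mul (c * a)
      exact h.congr_deriv (by simp only [id]; ring)
  have cont_term : ∀ (c a b : ℝ), 0 ≤ a → 0 ≤ b → (b = 0 → c * a = 0) →
      ContinuousOn (fun t => c * a * Real.log (b + t * a)) (Set.Ici 0) := by
    intro c a b ha hb hs
    rcases hb.eq_or_lt with h | h
    · simp only [hs h.symm, zero_mul]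
      exact continuousOn_const
    · refine continuousOn_const.mul (ContinuousOn.log (by fun_prop) fun t ht => ?_)
      have : (0 : ℝ) ≤ t := ht
      positivity
  have lim_term : ∀ (c a b : ℝ), 0 ≤ a →
      Tendsto (fun t => c * a * Real.log (b + t * a) - c * a * Real.log t) atTop
        (𝓝 (c * a * Real.log a)) := by
    intro c a b ha
    rcases ha.eq_or_lt with rfl | ha
    · simp
    · have h1 : Tendsto (fun t : ℝ => b / t + a) atTop (𝓝 a) := by
        simpa using (tendsto_const_nhds.div_atTop tendsto_id : Tendsto (fun t : ℝ => b / t)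
          atTop (𝓝 0)).add_const a
      have h2 := ((Real.continuousAt_log ha.ne').tendsto.comp h1).const_mul (c * a)
      refine h2.congr' ?_
      have hev : ∀ᶠ t : ℝ in atTop, b / t + a ≠ 0 := h1.eventually_ne ha.ne'
      filter_upwards [hev, eventually_gt_atTop 0] with t ht1 ht
      have : b + t * a = t * (b / t + a) := by field_simp
      rw [this, Real.log_mul ht.ne' ht1]
      simp only [Function.comp]
      ring
  set D : ℝ → ℝ := fun t => ∑ i, c i * a i * Real.log (b i + t * a i) -
    ∑ i, c' i * a' i * Real.log (b' i + t * a' i) with hD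
  have hderiv : ∀ t > 0, HasDerivAt D (∑ i, c i * (a i ^ 2 / (b i + t * a i)) -
      ∑ i, c' i * (a' i ^ 2 / (b' i + t * a' i))) t := fun t ht =>
    (HasDerivAt.fun_sum fun i _ => deriv_term _ _ _ (ha i) (hb i) t ht).sub
      (HasDerivAt.fun_sum fun i _ => deriv_term _ _ _ (ha' i) (hb' i) t ht)
  have hmono : MonotoneOn D (Set.Ici 0) := by
    refine monotoneOn_of_deriv_nonneg (convex_Ici 0) ?_ ?_ ?_
    · exact (continuousOn_finsetSum _ fun i _ => cont_term _ _ _ (ha i) (hb i) (hs i)).sub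
        (continuousOn_finsetSum _ fun i _ => cont_term _ _ _ (ha' i) (hb' i) (hs' i))
    · rw [interior_Ici]
      exact fun t ht => (hderiv t ht).differentiableAt.differentiableWithinAt
    · rw [interior_Ici]
      intro t ht
      rw [(hderiv t ht).deriv]
      linarith [hres t ht]
  have hlim : Tendsto D atTop
      (𝓝 (∑ i, c i * a i * Real.log (a i) - ∑ i, c' i * a' i * Real.log (a' i))) := by
    have h := (tendsto_finsetSum Finset.univ fun i _ => lim_term (c i) (a i) (b i) (ha i)).sub
      (tendsto_finsetSum Finset.univ fun i _ => lim_term (c' i) (a' i) (b' i) (ha' i))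
    refine h.congr fun t => ?_
    simp only [Finset.sum_sub_distrib, ← Finset.sum_mul, hmass, hD]
    ring
  have hle : D 0 ≤ _ := ge_of_tendsto hlim <| by
    filter_upwards [eventually_ge_atTop 0] with t ht
    exact hmono Set.self_mem_Ici ht ht
  simp only [hD, zero_mul, add_zero] at hle
  simp only [mul_sub, Finset.sum_sub_distrib]
  linarith

variable {d : ℕ}

/-- The functional `X ↦ 2 Re Tr(X† A) - Tr(X† B X) - t Tr(X A X†)`, whose supremum over `X`
is `⟨A, (L_B + t R_A)⁻¹ A⟩` in the Hilbert–Schmidt inner product. -/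
noncomputable def resolventForm (A B : Matrix (Fin d) (Fin d) ℂ) (t : ℝ)
    (X : Matrix (Fin d) (Fin d) ℂ) : ℝ :=
  2 * (Matrix.trace (Xᴴ * A)).re - (Matrix.trace (Xᴴ * B * X)).re -
    t * (Matrix.trace (X * A * Xᴴ)).re

/-- The matrix of inner products between the eigenvectors of `B` and those of `A`. -/
noncomputable def eigenOverlap {A B : Matrix (Fin d) (Fin d) ℂ} (hA : A.IsHermitian) (hB : B.IsHermitian) :
    Matrix (Fin d) (Fin d) ℂ :=
  star (hB.eigenvectorUnitary : Matrix (Fin d) (Fin d) ℂ) * hA.eigenvectorUnitary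

lemma eq_eigenvectorUnitary_mul_diagonal {A : Matrix (Fin d) (Fin d) ℂ} (hA : A.IsHermitian) :
    A = (hA.eigenvectorUnitary : Matrix (Fin d) (Fin d) ℂ) *
      Matrix.diagonal (fun i => (hA.eigenvalues i : ℂ)) *
      star (hA.eigenvectorUnitary : Matrix (Fin d) (Fin d) ℂ) := by
  conv_lhs => rw [hA.spectral_theorem, Unitary.conjStarAlgAut_apply]
  rfl

lemma star_eigenvectorUnitary_mul_self {A : Matrix (Fin d) (Fin d) ℂ} (hA : A.IsHermitian) :
    star (hA.eigenvectorUnitary : Matrix (Fin d) (Fin d) ℂ) * hA.eigenvectorUnitary = 1 :=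
  Unitary.coe_star_mul_self _

lemma eigenvectorUnitary_mul_star_self {A : Matrix (Fin d) (Fin d) ℂ} (hA : A.IsHermitian) :
    (hA.eigenvectorUnitary : Matrix (Fin d) (Fin d) ℂ) *
      star (hA.eigenvectorUnitary : Matrix (Fin d) (Fin d) ℂ) = 1 :=
  Unitary.coe_mul_star_self _

lemma trace_diagonal_mul_mul_diagonal_mul_conjTranspose (a b : Fin d → ℝ)
    (M : Matrix (Fin d) (Fin d) ℂ) :
    (Matrix.trace (Matrix.diagonal (fun i => (b i : ℂ)) * M *
      Matrix.diagonal (fun i => (a i : ℂ)) * Mᴴ)).re =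
      ∑ x : Fin d × Fin d, Complex.normSq (M x.1 x.2) * (a x.2 * b x.1) := by
  rw [Fintype.sum_prod_type, Matrix.trace, Complex.re_sum]
  refine Finset.sum_congr rfl fun i _ => ?_
  rw [Matrix.diag_apply, Matrix.mul_apply, Complex.re_sum]
  refine Finset.sum_congr rfl fun j _ => ?_
  simp only [Matrix.mul_diagonal, Matrix.diagonal_mul, Matrix.conjTranspose_apply,
    Complex.star_def, Complex.normSq_apply, Complex.mul_re, Complex.mul_im, Complex.conj_re,
    Complex.conj_im, Complex.ofReal_re, Complex.ofReal_im]
  ring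

/-- The trace of a product of a function of `A` and a function of `B` in terms of the overlaps. -/
lemma trace_spectral_mul_spectral {A B : Matrix (Fin d) (Fin d) ℂ} (hA : A.IsHermitian)
    (hB : B.IsHermitian) (f g : Fin d → ℝ) :
    (Matrix.trace ((hA.eigenvectorUnitary : Matrix (Fin d) (Fin d) ℂ) *
        Matrix.diagonal (fun i => (f i : ℂ)) *
        star (hA.eigenvectorUnitary : Matrix (Fin d) (Fin d) ℂ) *
      ((hB.eigenvectorUnitary : Matrix (Fin d) (Fin d) ℂ) *
        Matrix.diagonal (fun i => (g i : ℂ)) *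
        star (hB.eigenvectorUnitary : Matrix (Fin d) (Fin d) ℂ)))).re =
      ∑ x : Fin d × Fin d, Complex.normSq (eigenOverlap hA hB x.1 x.2) * (f x.2 * g x.1) := by
  rw [← trace_diagonal_mul_mul_diagonal_mul_conjTranspose f g, eigenOverlap,
    Matrix.conjTranspose_mul, ← Matrix.star_eq_conjTranspose, ← Matrix.star_eq_conjTranspose,
    star_star, Matrix.trace_mul_comm]
  simp only [Matrix.mul_assoc]
  rw [Matrix.trace_mul_comm]
  simp only [Matrix.mul_assoc]

lemma trace_eq_sum_eigenOverlap {A B : Matrix (Fin d) (Fin d) ℂ} (hA : A.IsHermitian)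
    (hB : B.IsHermitian) :
    (Matrix.trace A).re = ∑ x : Fin d × Fin d,
      Complex.normSq (eigenOverlap hA hB x.1 x.2) * hA.eigenvalues x.2 := by
  have h := trace_spectral_mul_spectral hA hB hA.eigenvalues (fun _ => 1)
  rw [← eq_eigenvectorUnitary_mul_diagonal hA] at h
  simpa [eigenvectorUnitary_mul_star_self] using h

lemma qRelEntropy_eq_sum_eigenOverlap {A B : Matrix (Fin d) (Fin d) ℂ} (hA : A.IsHermitian)
    (hB : B.IsHermitian) :
    qRelEntropy A B = ∑ x : Fin d × Fin d,
      Complex.normSq (eigenOverlap hA hB x.1 x.2) * hA.eigenvalues x.2 *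
        (Real.log (hA.eigenvalues x.2) - Real.log (hB.eigenvalues x.1)) := by
  have h1 := trace_spectral_mul_spectral hA hB
    (fun i => hA.eigenvalues i * Real.log (hA.eigenvalues i)) (fun _ => 1)
  have h2 := trace_spectral_mul_spectral hA hB hA.eigenvalues
    (fun i => Real.log (hB.eigenvalues i))
  have hAA : A * matLog A = (hA.eigenvectorUnitary : Matrix (Fin d) (Fin d) ℂ) *
      Matrix.diagonal (fun i => ((hA.eigenvalues i * Real.log (hA.eigenvalues i) : ℝ) : ℂ)) *
      star (hA.eigenvectorUnitary : Matrix (Fin d) (Fin d) ℂ) := by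
    conv_lhs => rw [matLog, dif_pos hA]; enter [1]; rw [eq_eigenvectorUnitary_mul_diagonal hA]
    simp only [Matrix.mul_assoc, Complex.ofReal_mul]
    rw [← Matrix.mul_assoc (star (hA.eigenvectorUnitary : Matrix (Fin d) (Fin d) ℂ)),
      star_eigenvectorUnitary_mul_self, Matrix.one_mul,
      ← Matrix.mul_assoc (Matrix.diagonal _), Matrix.diagonal_mul_diagonal]
  rw [← hAA] at h1
  rw [← eq_eigenvectorUnitary_mul_diagonal hA] at h2
  simp only [Complex.ofReal_one, Matrix.diagonal_one, Matrix.mul_one,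
    eigenvectorUnitary_mul_star_self] at h1
  rw [qRelEntropy, Matrix.mul_sub, Matrix.trace_sub, Complex.sub_re, h1, matLog, dif_pos hB, h2,
    ← Finset.sum_sub_distrib]
  exact Finset.sum_congr rfl fun x _ => by ring

lemma normSq_eigenOverlap_mul_eigenvalues_eq_zero {A B : Matrix (Fin d) (Fin d) ℂ}
    (hA : A.PosSemidef) (hB : B.PosSemidef) {C : ℝ} (hAB : (C • B - A).PosSemidef)
    (i j : Fin d) (hi : hB.1.eigenvalues i = 0) :
    Complex.normSq (eigenOverlap hA.1 hB.1 i j) * hA.1.eigenvalues j = 0 := by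
  set W := (hB.1.eigenvectorUnitary : Matrix (Fin d) (Fin d) ℂ) with hW
  have hdiagB : (Wᴴ * B * W) i i = 0 := by
    have : Wᴴ * B * W = Matrix.diagonal (fun i => (hB.1.eigenvalues i : ℂ)) := by
      conv_lhs => rw [eq_eigenvectorUnitary_mul_diagonal hB.1]
      rw [← Matrix.star_eq_conjTranspose]
      simp only [Matrix.mul_assoc]
      rw [star_eigenvectorUnitary_mul_self, Matrix.mul_one, ← Matrix.mul_assoc,
        star_eigenvectorUnitary_mul_self, Matrix.one_mul]
    rw [this, Matrix.diagonal_apply_eq, hi, Complex.ofReal_zero]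
  have hdiagA : ((Wᴴ * A * W) i i).re =
      ∑ j, Complex.normSq (eigenOverlap hA.1 hB.1 i j) * hA.1.eigenvalues j := by
    have : Wᴴ * A * W = eigenOverlap hA.1 hB.1 *
        Matrix.diagonal (fun i => (hA.1.eigenvalues i : ℂ)) * (eigenOverlap hA.1 hB.1)ᴴ := by
      conv_lhs => rw [eq_eigenvectorUnitary_mul_diagonal hA.1]
      rw [eigenOverlap, Matrix.conjTranspose_mul, ← Matrix.star_eq_conjTranspose,
        ← Matrix.star_eq_conjTranspose, ← Matrix.star_eq_conjTranspose, star_star]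
      simp only [Matrix.mul_assoc, hW]
    rw [this, Matrix.mul_apply, Complex.re_sum]
    refine Finset.sum_congr rfl fun j _ => ?_
    simp only [Matrix.mul_diagonal, Matrix.conjTranspose_apply,
      Complex.star_def, Complex.normSq_apply, Complex.mul_re, Complex.mul_im, Complex.conj_re,
      Complex.conj_im, Complex.ofReal_re, Complex.ofReal_im]
    ring
  have hle : 0 ≤ ((Wᴴ * (C • B - A) * W) i i).re :=
    (Complex.le_def.1 (hAB.conjTranspose_mul_mul_same W).diag_nonneg).1
  rw [Matrix.mul_sub, Matrix.sub_mul, Matrix.mul_smul, Matrix.smul_mul, Matrix.sub_apply,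
    Matrix.smul_apply, hdiagB, smul_zero, zero_sub, Complex.neg_re, hdiagA] at hle
  have hnonneg : ∀ j ∈ Finset.univ, 0 ≤
      Complex.normSq (eigenOverlap hA.1 hB.1 i j) * hA.1.eigenvalues j :=
    fun j _ => mul_nonneg (Complex.normSq_nonneg _) (hA.eigenvalues_nonneg j)
  exact (Finset.sum_eq_zero_iff_of_nonneg hnonneg).1
    (le_antisymm (by linarith) (Finset.sum_nonneg hnonneg)) j (Finset.mem_univ j)

/-- The form in coordinates with respect to the eigenbases of `B` and `A`. -/
lemma resolventForm_eq_sum {A B : Matrix (Fin d) (Fin d) ℂ} (hA : A.IsHermitian)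
    (hB : B.IsHermitian) (t : ℝ) (Z : Matrix (Fin d) (Fin d) ℂ) :
    resolventForm A B t ((hB.eigenvectorUnitary : Matrix (Fin d) (Fin d) ℂ) * Z *
        star (hA.eigenvectorUnitary : Matrix (Fin d) (Fin d) ℂ)) =
      ∑ x : Fin d × Fin d,
        (2 * hA.eigenvalues x.2 * (star (Z x.1 x.2) * eigenOverlap hA hB x.1 x.2).re -
          Complex.normSq (Z x.1 x.2) * (hB.eigenvalues x.1 + t * hA.eigenvalues x.2)) := by
  set U := (hA.eigenvectorUnitary : Matrix (Fin d) (Fin d) ℂ) with hU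
  set W := (hB.eigenvectorUnitary : Matrix (Fin d) (Fin d) ℂ) with hW
  set a := Matrix.diagonal (fun i => (hA.eigenvalues i : ℂ)) with ha
  set b := Matrix.diagonal (fun i => (hB.eigenvalues i : ℂ)) with hb
  have hUU : Uᴴ * U = 1 := star_eigenvectorUnitary_mul_self hA
  have hWW : Wᴴ * W = 1 := star_eigenvectorUnitary_mul_self hB
  have hAe : A = U * a * Uᴴ := eq_eigenvectorUnitary_mul_diagonal hA
  have hBe : B = W * b * Wᴴ := eq_eigenvectorUnitary_mul_diagonal hB
  have cancelU : ∀ Y : Matrix (Fin d) (Fin d) ℂ, Uᴴ * (U * Y) = Y := fun Y => by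
    rw [← Matrix.mul_assoc, hUU, Matrix.one_mul]
  have cancelW : ∀ Y : Matrix (Fin d) (Fin d) ℂ, Wᴴ * (W * Y) = Y := fun Y => by
    rw [← Matrix.mul_assoc, hWW, Matrix.one_mul]
  have hM : eigenOverlap hA hB = Wᴴ * U := rfl
  have t1 : Matrix.trace ((W * Z * star U)ᴴ * A) = Matrix.trace (Zᴴ * (eigenOverlap hA hB * a)) := by
    conv_lhs => rw [hAe]
    simp only [Matrix.star_eq_conjTranspose, Matrix.conjTranspose_mul,
      Matrix.conjTranspose_conjTranspose, Matrix.mul_assoc, hM]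
    rw [Matrix.trace_mul_comm]
    simp only [Matrix.mul_assoc, hUU, Matrix.mul_one]
  have t2 : Matrix.trace ((W * Z * star U)ᴴ * B * (W * Z * star U)) =
      Matrix.trace (Zᴴ * (b * Z)) := by
    conv_lhs => rw [hBe]
    simp only [Matrix.star_eq_conjTranspose, Matrix.conjTranspose_mul,
      Matrix.conjTranspose_conjTranspose, Matrix.mul_assoc, cancelW]
    rw [Matrix.trace_mul_comm]
    simp only [Matrix.mul_assoc, hUU, Matrix.mul_one]
  have t3 : Matrix.trace ((W * Z * star U) * A * (W * Z * star U)ᴴ) =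
      Matrix.trace (Z * (a * Zᴴ)) := by
    conv_lhs => rw [hAe]
    simp only [Matrix.star_eq_conjTranspose, Matrix.conjTranspose_mul,
      Matrix.conjTranspose_conjTranspose, Matrix.mul_assoc, cancelU]
    rw [Matrix.trace_mul_comm]
    simp only [Matrix.mul_assoc, hWW, Matrix.mul_one]
  have s1 : (Matrix.trace (Zᴴ * (eigenOverlap hA hB * a))).re = ∑ x : Fin d × Fin d,
      hA.eigenvalues x.2 * (star (Z x.1 x.2) * eigenOverlap hA hB x.1 x.2).re := by
    rw [Fintype.sum_prod_type_right, Matrix.trace, Complex.re_sum]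
    refine Finset.sum_congr rfl fun j _ => ?_
    rw [Matrix.diag_apply, Matrix.mul_apply, Complex.re_sum]
    refine Finset.sum_congr rfl fun i _ => ?_
    rw [ha, Matrix.mul_diagonal, Matrix.conjTranspose_apply, ← mul_assoc, Complex.re_mul_ofReal,
      mul_comm]
  have s2 : (Matrix.trace (Zᴴ * (b * Z))).re = ∑ x : Fin d × Fin d,
      Complex.normSq (Z x.1 x.2) * hB.eigenvalues x.1 := by
    rw [Fintype.sum_prod_type_right, Matrix.trace, Complex.re_sum]
    refine Finset.sum_congr rfl fun j _ => ?_
    rw [Matrix.diag_apply, Matrix.mul_apply, Complex.re_sum]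
    refine Finset.sum_congr rfl fun i _ => ?_
    simp only [hb, Matrix.diagonal_mul, Matrix.conjTranspose_apply,
      Complex.star_def, Complex.normSq_apply, Complex.mul_re, Complex.mul_im, Complex.conj_re,
      Complex.conj_im, Complex.ofReal_re, Complex.ofReal_im]
    ring
  have s3 : (Matrix.trace (Z * (a * Zᴴ))).re = ∑ x : Fin d × Fin d,
      Complex.normSq (Z x.1 x.2) * hA.eigenvalues x.2 := by
    rw [Fintype.sum_prod_type, Matrix.trace, Complex.re_sum]
    refine Finset.sum_congr rfl fun i _ => ?_
    rw [Matrix.diag_apply, Matrix.mul_apply, Complex.re_sum]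
    refine Finset.sum_congr rfl fun j _ => ?_
    simp only [ha, Matrix.diagonal_mul, Matrix.conjTranspose_apply,
      Complex.star_def, Complex.normSq_apply, Complex.mul_re, Complex.mul_im, Complex.conj_re,
      Complex.conj_im, Complex.ofReal_re, Complex.ofReal_im]
    ring
  rw [resolventForm, t1, t2, t3, s1, s2, s3, Finset.mul_sum, Finset.mul_sum,
    ← Finset.sum_sub_distrib, ← Finset.sum_sub_distrib]
  exact Finset.sum_congr rfl fun x _ => by ring

lemma resolventForm_le_sum {A B : Matrix (Fin d) (Fin d) ℂ} (hA : A.PosSemidef)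
    (hB : B.PosSemidef) {t : ℝ} (ht : 0 < t) (X : Matrix (Fin d) (Fin d) ℂ) :
    resolventForm A B t X ≤ ∑ x : Fin d × Fin d,
      Complex.normSq (eigenOverlap hA.1 hB.1 x.1 x.2) *
        (hA.1.eigenvalues x.2 ^ 2 / (hB.1.eigenvalues x.1 + t * hA.1.eigenvalues x.2)) := by
  have hX : X = (hB.1.eigenvectorUnitary : Matrix (Fin d) (Fin d) ℂ) *
      (star (hB.1.eigenvectorUnitary : Matrix (Fin d) (Fin d) ℂ) * X * hA.1.eigenvectorUnitary) *
      star (hA.1.eigenvectorUnitary : Matrix (Fin d) (Fin d) ℂ) := by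
    simp only [Matrix.mul_assoc, eigenvectorUnitary_mul_star_self, Matrix.mul_one]
    rw [← Matrix.mul_assoc, eigenvectorUnitary_mul_star_self, Matrix.one_mul]
  rw [hX, resolventForm_eq_sum]
  refine Finset.sum_le_sum fun x _ => ?_
  have ha := hA.eigenvalues_nonneg x.2
  have hb := hB.eigenvalues_nonneg x.1
  generalize hA.1.eigenvalues x.2 = a at *
  generalize hB.1.eigenvalues x.1 = b at *
  generalize eigenOverlap hA.1 hB.1 x.1 x.2 = m
  generalize (star (hB.1.eigenvectorUnitary : Matrix (Fin d) (Fin d) ℂ) * X *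
    hA.1.eigenvectorUnitary) x.1 x.2 = z
  simp only [Complex.star_def, Complex.mul_re, Complex.conj_re, Complex.conj_im,
    Complex.normSq_apply]
  rcases ha.eq_or_lt with rfl | ha
  · simp only [mul_zero, zero_mul, zero_sub, add_zero, ne_eq, OfNat.ofNat_ne_zero,
      not_false_eq_true, zero_pow, zero_div]
    have := mul_nonneg (add_nonneg (mul_self_nonneg z.re) (mul_self_nonneg z.im)) hb
    linarith
  · have hpos : 0 < b + t * a := by positivity
    rw [← mul_div_assoc, le_div_iff₀ hpos]
    nlinarith [sq_nonneg (m.re * a - z.re * (b + t * a)), sq_nonneg (m.im * a - z.im * (b + t * a))]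

lemma exists_resolventForm_eq_sum {A B : Matrix (Fin d) (Fin d) ℂ} (hA : A.PosSemidef)
    (hB : B.PosSemidef) {t : ℝ} (ht : 0 < t) :
    ∃ X, resolventForm A B t X = ∑ x : Fin d × Fin d,
      Complex.normSq (eigenOverlap hA.1 hB.1 x.1 x.2) *
        (hA.1.eigenvalues x.2 ^ 2 / (hB.1.eigenvalues x.1 + t * hA.1.eigenvalues x.2)) := by
  refine ⟨_, (resolventForm_eq_sum hA.1 hB.1 t (Matrix.of fun i j =>
    ((hA.1.eigenvalues j / (hB.1.eigenvalues i + t * hA.1.eigenvalues j) : ℝ) : ℂ) *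
      eigenOverlap hA.1 hB.1 i j)).trans (Finset.sum_congr rfl fun x _ => ?_)⟩
  have ha := hA.eigenvalues_nonneg x.2
  have hb := hB.eigenvalues_nonneg x.1
  rw [Matrix.of_apply]
  generalize hA.1.eigenvalues x.2 = a at *
  generalize hB.1.eigenvalues x.1 = b at *
  generalize eigenOverlap hA.1 hB.1 x.1 x.2 = m
  rw [Complex.normSq_mul, Complex.normSq_ofReal, Complex.star_def, map_mul, Complex.conj_ofReal,
    mul_assoc _ (starRingEnd ℂ m) m, ← Complex.normSq_eq_conj_mul_self,
    ← Complex.ofReal_mul, Complex.ofReal_re]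
  rcases ha.eq_or_lt with rfl | ha
  · simp
  · have hpos : b + t * a ≠ 0 := by positivity
    field_simp
    ring

/-- Kadison–Schwarz inequality for the unital map `Y ↦ ∑ V† Y V`, tested against a positive
semidefinite matrix. -/
lemma trace_conjTranspose_mul_mul_le_sum {κ : Type*} [Fintype κ]
    (V Y : κ → Matrix (Fin d) (Fin d) ℂ) (hV : ∑ k, (V k)ᴴ * V k = 1)
    {B : Matrix (Fin d) (Fin d) ℂ} (hB : B.PosSemidef) :
    (Matrix.trace ((∑ k, (V k)ᴴ * Y k * V k)ᴴ * B * ∑ k, (V k)ᴴ * Y k * V k)).re ≤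
      ∑ k, (Matrix.trace ((Y k)ᴴ * (V k * B * (V k)ᴴ) * Y k)).re := by
  set X := ∑ k, (V k)ᴴ * Y k * V k with hX
  have hXH : Xᴴ = ∑ k, (V k)ᴴ * (Y k)ᴴ * V k := by
    simp [hX, Matrix.conjTranspose_sum, Matrix.conjTranspose_mul, Matrix.mul_assoc]
  have hnonneg : ∀ k, 0 ≤ (Matrix.trace (((Y k)ᴴ * V k - V k * Xᴴ) * B *
      ((Y k)ᴴ * V k - V k * Xᴴ)ᴴ)).re := fun k =>
    (Complex.le_def.1 (hB.mul_mul_conjTranspose_same _).trace_nonneg).1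
  have hexp : ∀ k, Matrix.trace (((Y k)ᴴ * V k - V k * Xᴴ) * B * ((Y k)ᴴ * V k - V k * Xᴴ)ᴴ) =
      Matrix.trace ((Y k)ᴴ * (V k * B * (V k)ᴴ) * Y k) -
      Matrix.trace ((B * X) * ((V k)ᴴ * (Y k)ᴴ * V k)) -
      Matrix.trace ((Xᴴ * B) * ((V k)ᴴ * Y k * V k)) +
      Matrix.trace ((Xᴴ * B * X) * ((V k)ᴴ * V k)) := by
    intro k
    have e1 : Matrix.trace ((B * X) * ((V k)ᴴ * (Y k)ᴴ * V k)) =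
        Matrix.trace ((Y k)ᴴ * V k * B * (X * (V k)ᴴ)) := by
      rw [← Matrix.mul_assoc, ← Matrix.mul_assoc, Matrix.mul_assoc, Matrix.trace_mul_comm]
      simp only [Matrix.mul_assoc]
    have e2 : Matrix.trace ((Xᴴ * B) * ((V k)ᴴ * Y k * V k)) =
        Matrix.trace (V k * Xᴴ * B * ((V k)ᴴ * Y k)) := by
      rw [← Matrix.mul_assoc, Matrix.trace_mul_comm]
      simp only [Matrix.mul_assoc]
    have e3 : Matrix.trace ((Xᴴ * B * X) * ((V k)ᴴ * V k)) =
        Matrix.trace (V k * Xᴴ * B * (X * (V k)ᴴ)) := by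
      rw [← Matrix.mul_assoc, Matrix.trace_mul_comm]
      simp only [Matrix.mul_assoc]
    rw [e1, e2, e3]
    simp only [Matrix.conjTranspose_sub, Matrix.conjTranspose_mul,
      Matrix.conjTranspose_conjTranspose, Matrix.sub_mul, Matrix.mul_sub, Matrix.trace_sub,
      Matrix.mul_assoc]
    ring
  have hsum : ∑ k, Matrix.trace (((Y k)ᴴ * V k - V k * Xᴴ) * B * ((Y k)ᴴ * V k - V k * Xᴴ)ᴴ) =
      ∑ k, Matrix.trace ((Y k)ᴴ * (V k * B * (V k)ᴴ) * Y k) - Matrix.trace (Xᴴ * B * X) := by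
    rw [Finset.sum_congr rfl fun k _ => hexp k, Finset.sum_add_distrib, Finset.sum_sub_distrib,
      Finset.sum_sub_distrib]
    simp only [← Matrix.trace_sum, ← Matrix.mul_sum, hV, ← hX, ← hXH]
    rw [Matrix.mul_one, Matrix.trace_mul_comm (B * X), ← Matrix.mul_assoc]
    ring
  have h := Finset.sum_nonneg fun k (_ : k ∈ Finset.univ) => hnonneg k
  rw [← Complex.re_sum, hsum, Complex.sub_re, Complex.re_sum] at h
  linarith

lemma posSemidef_instrOp {Ω K : Type*} [Fintype K] (V : Ω → K → Matrix (Fin d) (Fin d) ℂ) (ω : Ω)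
    {A : Matrix (Fin d) (Fin d) ℂ} (hA : A.PosSemidef) : (instrOp V ω A).PosSemidef :=
  Matrix.posSemidef_sum _ fun k _ => hA.mul_mul_conjTranspose_same (V ω k)

lemma instrOp_sub {Ω K : Type*} [Fintype K] (V : Ω → K → Matrix (Fin d) (Fin d) ℂ) (ω : Ω)
    (A B : Matrix (Fin d) (Fin d) ℂ) : instrOp V ω (A - B) = instrOp V ω A - instrOp V ω B := by
  simp only [instrOp, Matrix.mul_sub, Matrix.sub_mul, Finset.sum_sub_distrib]

lemma instrOp_smul {Ω K : Type*} [Fintype K] (V : Ω → K → Matrix (Fin d) (Fin d) ℂ) (ω : Ω)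
    (c : ℝ) (A : Matrix (Fin d) (Fin d) ℂ) : instrOp V ω (c • A) = c • instrOp V ω A := by
  simp only [instrOp, Matrix.mul_smul, Matrix.smul_mul, Finset.smul_sum]

lemma instrOp_sum {Ω K ι : Type*} [Fintype K] (V : Ω → K → Matrix (Fin d) (Fin d) ℂ) (ω : Ω)
    (s : Finset ι) (A : ι → Matrix (Fin d) (Fin d) ℂ) :
    instrOp V ω (∑ i ∈ s, A i) = ∑ i ∈ s, instrOp V ω (A i) := by
  simp only [instrOp, Finset.mul_sum, Finset.sum_mul]
  exact Finset.sum_comm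

lemma outcomeProb_eq_trace_instrOp {Ω K : Type*} [Fintype K]
    (V : Ω → K → Matrix (Fin d) (Fin d) ℂ) (A : Matrix (Fin d) (Fin d) ℂ) (ω : Ω) :
    outcomeProb V A ω = (Matrix.trace (instrOp V ω A)).re := by
  simp only [outcomeProb, instrPOV, instrOp, Finset.sum_mul, Matrix.trace_sum]
  congr 1
  refine Finset.sum_congr rfl fun k _ => ?_
  rw [Matrix.mul_assoc, Matrix.trace_mul_comm]

lemma sum_outcomeProb {Ω K : Type*} [Fintype Ω] [Fintype K]
    (V : Ω → K → Matrix (Fin d) (Fin d) ℂ) (hV : ∑ ω, instrPOV V ω = 1)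
    (A : Matrix (Fin d) (Fin d) ℂ) :
    ∑ ω, outcomeProb V A ω = (Matrix.trace A).re := by
  simp only [outcomeProb]
  rw [← Complex.re_sum, ← Matrix.trace_sum, ← Finset.sum_mul, hV, Matrix.one_mul]

lemma sum_resolventForm_instrOp_le {Ω K : Type*} [Fintype Ω] [Fintype K]
    (V : Ω → K → Matrix (Fin d) (Fin d) ℂ) (hV : ∑ ω, instrPOV V ω = 1)
    {A B : Matrix (Fin d) (Fin d) ℂ} (hA : A.PosSemidef) (hB : B.PosSemidef) {t : ℝ} (ht : 0 < t)
    (Y : Ω → Matrix (Fin d) (Fin d) ℂ) :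
    ∑ ω, resolventForm (instrOp V ω A) (instrOp V ω B) t (Y ω) ≤
      resolventForm A B t (∑ x : Ω × K, (V x.1 x.2)ᴴ * Y x.1 * V x.1 x.2) := by
  have hV' : ∑ x : Ω × K, (V x.1 x.2)ᴴ * V x.1 x.2 = 1 := by
    rw [Fintype.sum_prod_type]; exact hV
  have h1 := trace_conjTranspose_mul_mul_le_sum (fun x : Ω × K => V x.1 x.2) (fun x => Y x.1) hV' hB
  have h2 := trace_conjTranspose_mul_mul_le_sum (fun x : Ω × K => V x.1 x.2)
    (fun x => (Y x.1)ᴴ) hV' hA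
  beta_reduce at h1 h2
  set X := ∑ x : Ω × K, (V x.1 x.2)ᴴ * Y x.1 * V x.1 x.2 with hX
  have hXH : ∑ x : Ω × K, (V x.1 x.2)ᴴ * (Y x.1)ᴴ * V x.1 x.2 = Xᴴ := by
    simp [hX, Matrix.conjTranspose_sum, Matrix.conjTranspose_mul, Matrix.mul_assoc]
  rw [hXH, Matrix.conjTranspose_conjTranspose] at h2
  have h3 : ∑ ω, (Matrix.trace ((Y ω)ᴴ * instrOp V ω A)).re = (Matrix.trace (Xᴴ * A)).re := by
    rw [← hXH, Finset.sum_mul, Matrix.trace_sum, Complex.re_sum, Fintype.sum_prod_type]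
    refine Finset.sum_congr rfl fun ω _ => ?_
    rw [instrOp, Finset.mul_sum, Matrix.trace_sum, Complex.re_sum]
    refine Finset.sum_congr rfl fun k _ => ?_
    rw [← Matrix.mul_assoc, Matrix.trace_mul_comm]
    simp only [Matrix.mul_assoc]
  have h4 : ∀ (Z : Ω → Matrix (Fin d) (Fin d) ℂ) (C : Matrix (Fin d) (Fin d) ℂ),
      ∑ x : Ω × K, (Matrix.trace ((Z x.1)ᴴ * (V x.1 x.2 * C * (V x.1 x.2)ᴴ) * Z x.1)).re =
      ∑ ω, (Matrix.trace ((Z ω)ᴴ * instrOp V ω C * Z ω)).re := by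
    intro Z C
    rw [Fintype.sum_prod_type]
    refine Finset.sum_congr rfl fun ω _ => ?_
    rw [instrOp, Finset.mul_sum, Finset.sum_mul, Matrix.trace_sum, Complex.re_sum]
  have h5 := h4 (fun ω => (Y ω)ᴴ) A
  simp only [Matrix.conjTranspose_conjTranspose] at h5 h2
  rw [h4] at h1
  rw [h5] at h2
  simp only [resolventForm, Finset.sum_sub_distrib, ← Finset.mul_sum, h3]
  nlinarith [mul_le_mul_of_nonneg_left h2 ht.le]

/-- Monotonicity of the quantum relative entropy under an instrument, the output being the
block-diagonal family of unnormalised a posteriori states. -/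
theorem sum_qRelEntropy_instrOp_le {Ω K : Type*} [Fintype Ω] [Fintype K]
    (V : Ω → K → Matrix (Fin d) (Fin d) ℂ) (hV : ∑ ω, instrPOV V ω = 1)
    {A B : Matrix (Fin d) (Fin d) ℂ} (hA : A.PosSemidef) (hB : B.PosSemidef) {C : ℝ}
    (hAB : (C • B - A).PosSemidef) :
    ∑ ω, qRelEntropy (instrOp V ω A) (instrOp V ω B) ≤ qRelEntropy A B := by
  have hA' := fun ω => posSemidef_instrOp V ω hA
  have hB' := fun ω => posSemidef_instrOp V ω hB
  have hAB' : ∀ ω, (C • instrOp V ω B - instrOp V ω A).PosSemidef := fun ω => by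
    rw [← instrOp_smul, ← instrOp_sub]
    exact posSemidef_instrOp V ω hAB
  have key := sum_mul_log_sub_log_le
    (fun x : Fin d × Fin d => Complex.normSq (eigenOverlap hA.1 hB.1 x.1 x.2))
    (fun x => hA.1.eigenvalues x.2) (fun x => hB.1.eigenvalues x.1)
    (fun y : Ω × Fin d × Fin d =>
      Complex.normSq (eigenOverlap (hA' y.1).1 (hB' y.1).1 y.2.1 y.2.2))
    (fun y => (hA' y.1).1.eigenvalues y.2.2) (fun y => (hB' y.1).1.eigenvalues y.2.1)
    (fun x => hA.eigenvalues_nonneg _) (fun x => hB.eigenvalues_nonneg _)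
    (fun y => (hA' y.1).eigenvalues_nonneg _) (fun y => (hB' y.1).eigenvalues_nonneg _)
    (fun x => normSq_eigenOverlap_mul_eigenvalues_eq_zero hA hB hAB _ _)
    (fun y => normSq_eigenOverlap_mul_eigenvalues_eq_zero (hA' y.1) (hB' y.1) (hAB' y.1) _ _)
    ?_ ?_
  · rw [qRelEntropy_eq_sum_eigenOverlap hA.1 hB.1]
    refine le_trans (le_of_eq ?_) key
    rw [Fintype.sum_prod_type]
    exact Finset.sum_congr rfl fun ω _ => qRelEntropy_eq_sum_eigenOverlap (hA' ω).1 (hB' ω).1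
  · rw [← trace_eq_sum_eigenOverlap hA.1 hB.1, ← sum_outcomeProb V hV A, Fintype.sum_prod_type]
    refine Finset.sum_congr rfl fun ω _ => ?_
    rw [outcomeProb_eq_trace_instrOp]
    exact (trace_eq_sum_eigenOverlap (hA' ω).1 (hB' ω).1).symm
  · intro t ht
    choose Y hY using fun ω => exists_resolventForm_eq_sum (hA' ω) (hB' ω) ht
    refine le_trans (le_of_eq ?_) ((sum_resolventForm_instrOp_le V hV hA hB ht Y).trans
      (resolventForm_le_sum hA hB ht _))
    rw [Fintype.sum_prod_type]
    exact Finset.sum_congr rfl fun ω _ => (hY ω).symm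

lemma matLog_eq_cfc {A : Matrix (Fin d) (Fin d) ℂ} (hA : A.IsHermitian) :
    matLog A = cfc Real.log A := by
  rw [hA.cfc_eq, matLog, dif_pos hA, Matrix.IsHermitian.cfc, Unitary.conjStarAlgAut_apply]
  rfl

lemma mul_matLog_eq_cfc {A : Matrix (Fin d) (Fin d) ℂ} (hA : A.IsHermitian) :
    A * matLog A = cfc (fun x : ℝ => x * Real.log x) A := by
  have hA' : IsSelfAdjoint A := hA
  rw [matLog_eq_cfc hA, cfc_mul (fun x : ℝ => x) Real.log A (by fun_prop)
    (Matrix.finite_real_spectrum.continuousOn _), cfc_id' ℝ A]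

lemma vnEntropy_smul {A : Matrix (Fin d) (Fin d) ℂ} (hA : A.IsHermitian) {c : ℝ} (hc : 0 < c) :
    vnEntropy (c • A) = c * vnEntropy A - c * Real.log c * (Matrix.trace A).re := by
  have hA' : IsSelfAdjoint A := hA
  have hcA : (c • A).IsHermitian := by
    rw [Matrix.IsHermitian, Matrix.conjTranspose_smul, star_trivial, hA.eq]
  have h : (c • A) * matLog (c • A) = c • (A * matLog A) + (c * Real.log c) • A := by
    rw [mul_matLog_eq_cfc hA, mul_matLog_eq_cfc hcA,
      ← cfc_comp_smul c (fun x : ℝ => x * Real.log x) A Real.continuous_mul_log.continuousOn,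
      ← cfc_const_mul_id (c * Real.log c) A,
      ← cfc_const_mul c (fun x : ℝ => x * Real.log x) A Real.continuous_mul_log.continuousOn,
      ← cfc_add A (fun x : ℝ => c * (x * Real.log x)) (fun x : ℝ => c * Real.log c * x)
        (Real.continuous_mul_log.const_mul c).continuousOn (by fun_prop)]
    refine cfc_congr fun x _ => ?_
    rcases eq_or_ne x 0 with rfl | hx
    · simp
    · simp only [smul_eq_mul]
      rw [Real.log_mul hc.ne' hx]
      ring
  rw [vnEntropy, vnEntropy, h, Matrix.trace_add, Matrix.trace_smul, Matrix.trace_smul,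
    Complex.add_re, Complex.smul_re, Complex.smul_re, smul_eq_mul, smul_eq_mul]
  ring

lemma infoGain_eq {Ω K : Type*} [Fintype Ω] [Fintype K] (V : Ω → K → Matrix (Fin d) (Fin d) ℂ)
    {A : Matrix (Fin d) (Fin d) ℂ} (hA : A.PosSemidef) :
    infoGain V A = vnEntropy A - ∑ ω, (vnEntropy (instrOp V ω A) +
      outcomeProb V A ω * Real.log (outcomeProb V A ω)) := by
  rw [infoGain, Finset.sum_filter]
  congr 1
  refine Finset.sum_congr rfl fun ω _ => ?_
  have hO := posSemidef_instrOp V ω hA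
  have htr := outcomeProb_eq_trace_instrOp V A ω
  split_ifs with h
  · rw [postState, vnEntropy_smul hO.1 (inv_pos.2 h), ← htr, Real.log_inv]
    field_simp
    ring
  · have hnn := Complex.le_def.1 hO.trace_nonneg
    have hz : instrOp V ω A = 0 := by
      rw [← hO.trace_eq_zero_iff]
      refine Complex.ext ?_ hnn.2.symm
      rw [htr] at h
      exact le_antisymm (not_lt.1 h) hnn.1
    rw [htr, hz]
    simp [vnEntropy]

lemma sum_mul_qRelEntropy {A : Type*} [Fintype A] (p : A → ℝ)
    (ρ : A → Matrix (Fin d) (Fin d) ℂ) :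
    ∑ α, p α * qRelEntropy (ρ α) (∑ β, p β • ρ β) =
      vnEntropy (∑ β, p β • ρ β) - ∑ α, p α * vnEntropy (ρ α) := by
  have h : (Matrix.trace ((∑ β, p β • ρ β) * matLog (∑ β, p β • ρ β))).re =
      ∑ α, p α * (Matrix.trace (ρ α * matLog (∑ β, p β • ρ β))).re := by
    rw [Finset.sum_mul, Matrix.trace_sum, Complex.re_sum]
    refine Finset.sum_congr rfl fun α _ => ?_
    rw [Matrix.smul_mul, Matrix.trace_smul, Complex.smul_re, smul_eq_mul]
  rw [vnEntropy, h]
  simp only [vnEntropy, qRelEntropy, mul_sub, Matrix.trace_sub, Complex.sub_re,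
    mul_neg, Finset.sum_sub_distrib, Finset.sum_neg_distrib]
  ring

lemma outcomeProb_nonneg {Ω K : Type*} [Fintype K] (V : Ω → K → Matrix (Fin d) (Fin d) ℂ)
    {A : Matrix (Fin d) (Fin d) ℂ} (hA : A.PosSemidef) (ω : Ω) : 0 ≤ outcomeProb V A ω := by
  rw [outcomeProb_eq_trace_instrOp]
  exact (Complex.le_def.1 (posSemidef_instrOp V ω hA).trace_nonneg).1

lemma outcomeProb_sum_smul {Ω K A : Type*} [Fintype K] [Fintype A]
    (V : Ω → K → Matrix (Fin d) (Fin d) ℂ) (p : A → ℝ) (ρ : A → Matrix (Fin d) (Fin d) ℂ)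
    (ω : Ω) : outcomeProb V (∑ α, p α • ρ α) ω = ∑ α, p α * outcomeProb V (ρ α) ω := by
  rw [outcomeProb, Finset.mul_sum, Matrix.trace_sum, Complex.re_sum]
  refine Finset.sum_congr rfl fun α _ => ?_
  rw [Matrix.mul_smul, Matrix.trace_smul, Complex.smul_re, smul_eq_mul, outcomeProb]

lemma posSemidef_sum_smul {A : Type*} (s : Finset A) {p : A → ℝ} (hp : ∀ α, 0 ≤ p α)
    {ρ : A → Matrix (Fin d) (Fin d) ℂ} (hρ : ∀ α, (ρ α).PosSemidef) :
    (∑ α ∈ s, p α • ρ α).PosSemidef :=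
  Matrix.posSemidef_sum _ fun α _ => (hρ α).smul (hp α)

lemma outcomeProb_sum_smul_pos {Ω K A : Type*} [Fintype K] [Fintype A] {p : A → ℝ}
    (hp : ∀ α, 0 ≤ p α) {ρ : A → Matrix (Fin d) (Fin d) ℂ} (hρ : ∀ α, (ρ α).PosSemidef)
    (V : Ω → K → Matrix (Fin d) (Fin d) ℂ) {α : A} {ω : Ω}
    (h : 0 < p α * outcomeProb V (ρ α) ω) : 0 < outcomeProb V (∑ α, p α • ρ α) ω := by
  rw [outcomeProb_sum_smul]
  exact h.trans_le (Finset.single_le_sum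
    (fun β _ => mul_nonneg (hp β) (outcomeProb_nonneg V (hρ β) ω)) (Finset.mem_univ α))

lemma mutualInfo_instrPOV_eq {A Ω K : Type*} [Fintype A] [Fintype Ω] [Fintype K]
    {p : A → ℝ} (hp : ∀ α, 0 ≤ p α) {ρ : A → Matrix (Fin d) (Fin d) ℂ}
    (hρ : ∀ α, (ρ α).PosSemidef) (V : Ω → K → Matrix (Fin d) (Fin d) ℂ) :
    mutualInfo p ρ (instrPOV V) =
      ∑ α, p α * ∑ ω, outcomeProb V (ρ α) ω * Real.log (outcomeProb V (ρ α) ω) -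
      ∑ ω, outcomeProb V (∑ α, p α • ρ α) ω *
        Real.log (outcomeProb V (∑ α, p α • ρ α) ω) := by
  have h : ∀ ω, outcomeProb V (∑ α, p α • ρ α) ω *
      Real.log (outcomeProb V (∑ α, p α • ρ α) ω) =
      ∑ α, p α * outcomeProb V (ρ α) ω * Real.log (outcomeProb V (∑ α, p α • ρ α) ω) := by
    intro ω
    rw [← Finset.sum_mul, ← outcomeProb_sum_smul]
  rw [Finset.sum_congr rfl fun ω _ => h ω, Finset.sum_comm, ← Finset.sum_sub_distrib, mutualInfo,
    Finset.sum_filter, Fintype.sum_prod_type]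
  refine Finset.sum_congr rfl fun α _ => ?_
  rw [Finset.mul_sum, ← Finset.sum_sub_distrib]
  refine Finset.sum_congr rfl fun ω _ => ?_
  change (if 0 < p α * outcomeProb V (ρ α) ω then (p α * outcomeProb V (ρ α) ω) *
    Real.log ((p α * outcomeProb V (ρ α) ω) / (p α * outcomeProb V (∑ α, p α • ρ α) ω)) else 0) = _
  have hq := outcomeProb_nonneg V (hρ α) ω
  split_ifs with hpos
  · have hpα : 0 < p α := (hp α).lt_of_ne' (left_ne_zero_of_mul hpos.ne')
    have hqpos : 0 < outcomeProb V (ρ α) ω := hq.lt_of_ne' (right_ne_zero_of_mul hpos.ne')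
    have hQ : 0 < outcomeProb V (∑ α, p α • ρ α) ω :=
      outcomeProb_sum_smul_pos hp hρ V hpos
    rw [mul_div_mul_left _ _ hpα.ne', Real.log_div hqpos.ne' hQ.ne']
    ring
  · have hz : p α * outcomeProb V (ρ α) ω = 0 :=
      le_antisymm (not_lt.1 hpos) (mul_nonneg (hp α) hq)
    rw [← mul_assoc, hz]
    simp

lemma mutualInfo_instrPOV_nonneg {A Ω K : Type*} [Fintype A] [Fintype Ω] [Fintype K]
    {p : A → ℝ} (hp : ∀ α, 0 ≤ p α) (hp1 : ∑ α, p α = 1) {ρ : A → Matrix (Fin d) (Fin d) ℂ}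
    (hρ : ∀ α, (ρ α).PosSemidef) (V : Ω → K → Matrix (Fin d) (Fin d) ℂ) :
    0 ≤ mutualInfo p ρ (instrPOV V) := by
  have hQ : ∀ ω, 0 ≤ outcomeProb V (∑ α, p α • ρ α) ω :=
    outcomeProb_nonneg V (posSemidef_sum_smul _ hp hρ)
  have hsum : ∑ x : A × Ω, (p x.1 * outcomeProb V (ρ x.1) x.2 -
      p x.1 * outcomeProb V (∑ α, p α • ρ α) x.2) = 0 := by
    rw [Finset.sum_sub_distrib, Fintype.sum_prod_type_right, Fintype.sum_prod_type_right,
      ← Finset.sum_sub_distrib]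
    refine Finset.sum_eq_zero fun ω _ => ?_
    dsimp only
    rw [← Finset.sum_mul, hp1, one_mul, ← outcomeProb_sum_smul, sub_self]
  rw [← hsum, mutualInfo, Finset.sum_filter]
  refine Finset.sum_le_sum fun ⟨α, ω⟩ _ => ?_
  change _ ≤ if 0 < p α * outcomeProb V (ρ α) ω then (p α * outcomeProb V (ρ α) ω) *
    Real.log ((p α * outcomeProb V (ρ α) ω) / (p α * outcomeProb V (∑ α, p α • ρ α) ω)) else 0
  have hq := outcomeProb_nonneg V (hρ α) ω
  split_ifs with hpos
  · have hpα : 0 < p α := (hp α).lt_of_ne' (left_ne_zero_of_mul hpos.ne')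
    have hQpos : 0 < outcomeProb V (∑ α, p α • ρ α) ω :=
      outcomeProb_sum_smul_pos hp hρ V hpos
    have hy := mul_pos hpα hQpos
    have hlog := Real.one_sub_inv_le_log_of_pos (div_pos hpos hy)
    refine le_trans (le_of_eq ?_) (mul_le_mul_of_nonneg_left hlog hpos.le)
    rw [inv_div, mul_sub, mul_one, mul_div_cancel₀ _ hpos.ne']
  · have := mul_nonneg (hp α) (hQ ω)
    linarith

/-- the generalized Groenewold–Lindblad inequality. -/
theorem generalized_groenewold_lindblad {d : ℕ} (hd : 1 ≤ d)
    {A Ω K : Type*} [Fintype A] [Fintype Ω] [Fintype K]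
    (p : A → ℝ) (hp : ∀ α, 0 ≤ p α) (hp1 : ∑ α, p α = 1)
    (ρ : A → Matrix (Fin d) (Fin d) ℂ)
    (hρ : ∀ α, (ρ α).PosSemidef) (hρtr : ∀ α, (ρ α).trace = 1)
    (V : Ω → K → Matrix (Fin d) (Fin d) ℂ)
    (hV : ∑ ω, instrPOV V ω = 1) :
    infoGain V (∑ α, p α • ρ α) - ∑ α, p α * infoGain V (ρ α) ≥
        mutualInfo p ρ (instrPOV V) ∧
      mutualInfo p ρ (instrPOV V) ≥ 0 := by
  refine ⟨?_, mutualInfo_instrPOV_nonneg hp hp1 hρ V⟩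
  have hη : (∑ α, p α • ρ α).PosSemidef := posSemidef_sum_smul _ hp hρ
  have hmono : ∑ α, p α * ∑ ω, qRelEntropy (instrOp V ω (ρ α)) (instrOp V ω (∑ β, p β • ρ β)) ≤
      ∑ α, p α * qRelEntropy (ρ α) (∑ β, p β • ρ β) := by
    refine Finset.sum_le_sum fun α _ => ?_
    rcases (hp α).eq_or_lt with h | h
    · rw [← h, zero_mul, zero_mul]
    · classical
      refine mul_le_mul_of_nonneg_left
        (sum_qRelEntropy_instrOp_le V hV (hρ α) hη (C := (p α)⁻¹) ?_) h.le
      rw [← Finset.add_sum_erase _ _ (Finset.mem_univ α), smul_add, smul_smul,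
        inv_mul_cancel₀ h.ne', one_smul, add_sub_cancel_left]
      exact (posSemidef_sum_smul _ hp hρ).smul (inv_nonneg.2 h.le)
  have hout : ∑ α, p α * ∑ ω, qRelEntropy (instrOp V ω (ρ α)) (instrOp V ω (∑ β, p β • ρ β)) =
      ∑ ω, vnEntropy (instrOp V ω (∑ β, p β • ρ β)) -
        ∑ α, p α * ∑ ω, vnEntropy (instrOp V ω (ρ α)) := by
    simp only [Finset.mul_sum]
    rw [Finset.sum_comm, Finset.sum_comm (f := fun α ω => p α * vnEntropy (instrOp V ω (ρ α))),
      ← Finset.sum_sub_distrib]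
    refine Finset.sum_congr rfl fun ω _ => ?_
    simp only [instrOp_sum, instrOp_smul]
    exact sum_mul_qRelEntropy p fun α => instrOp V ω (ρ α)
  rw [hout, sum_mul_qRelEntropy] at hmono
  rw [mutualInfo_instrPOV_eq hp hρ, infoGain_eq V hη,
    Finset.sum_congr rfl fun α _ => congrArg (p α * ·) (infoGain_eq V (hρ α))]
  simp only [mul_sub, mul_add, Finset.sum_add_distrib, Finset.sum_sub_distrib]
  linarith
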